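/- For every k ≥ 1 and every sequence (a_2, …, a_k) ∈ {↙, ↘}^{k−1}: {(↙, a_2, …, a_k)} = I_{l+1,t} · {(↘, a_2, …, a_k)}, where l is the number of symbols ↘ occurring among a_2, …, a_k. -/

import Mathlib

/-- The two arrow symbols `↙` (`sw`) and `↘` (`se`). -/
inductive Arrow : Type
  | sw  -- ↙ : multiply by `I_{1,t+r}`
  | se  -- ↘ : apply the shift `σ`
deriving DecidableEq

instance : Fintype Arrow where
  elems := {Arrow.sw, Arrow.se}
  complete := fun x => by cases x <;> decide

/-- The ring `R = ℂ[I_{n,s} : n, s ∈ ℤ]`, realized as multivariate polynomials in the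
variables `(n, s) : ℤ × ℤ` (the variable `(n, s)` is the indeterminate `I_{n,s}`). -/
abbrev TodaRing : Type := MvPolynomial (ℤ × ℤ) ℂ

/-- The shift homomorphism `σ : R → R`, `σ(I_{n,s}) = I_{n+1,s}`. -/
noncomputable def shiftσ : TodaRing →ₐ[ℂ] TodaRing :=
  MvPolynomial.rename (fun p => (p.1 + 1, p.2))

/-- Auxiliary bracket, recursing on the *last* element of the sequence: the argument list is
the sequence `(a_1, …, a_r)` in reverse order. -/
noncomputable def bracketAux (t : ℤ) : List Arrow → TodaRing
  | [] => 1
  | Arrow.sw :: rest => MvPolynomial.X ((1 : ℤ), t + rest.length) * bracketAux t rest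
  | Arrow.se :: rest => shiftσ (bracketAux t rest)

/-- The bracket `{(a_1, …, a_r)} ∈ R`, defined by `{()} = 1`,
`{(a_1, …, a_r, ↙)} = I_{1,t+r} · {(a_1, …, a_r)}` and
`{(a_1, …, a_r, ↘)} = σ({(a_1, …, a_r)})`. -/
noncomputable def bracket (t : ℤ) (a : List Arrow) : TodaRing :=
  bracketAux t a.reverse

/-- `u_j^{(k)}`: the sum of `{a}` over all sequences `a ∈ {↙,↘}^k` containing exactly
`j - 1` symbols `↘`. -/
noncomputable def uSum (t : ℤ) (j k : ℕ) : TodaRing :=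
  ∑ a ∈ Finset.univ.filter
      (fun a : Fin k → Arrow => (List.ofFn a).count Arrow.se = j - 1),
    bracket t (List.ofFn a)

theorem bracketAux_swap (t : ℤ) (l : List Arrow) :
    bracketAux t (l ++ [Arrow.sw]) =
      MvPolynomial.X (((l.count Arrow.se : ℤ) + 1, t)) * bracketAux t (l ++ [Arrow.se]) := by
  induction l with
  | nil => simp [bracketAux]
  | cons a l ih =>
    cases a with
    | sw =>
      simp only [List.cons_append, bracketAux, ih, List.length_append, List.length_singleton]
      rw [List.count_cons_of_ne (by decide)]
      ring
    | se =>
      simp only [List.cons_append, bracketAux, ih, map_mul, List.count_cons_self]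
      simp [shiftσ]

/-- Lemma A of the appendix: for `k ≥ 1` and `(a_2, …, a_k)`,
`{(↙, a_2, …, a_k)} = I_{l+1,t} · {(↘, a_2, …, a_k)}`, where `l` is the number of
symbols `↘` among `a_2, …, a_k`. -/
theorem bracket_swap_head (t : ℤ) (k : ℕ) (hk : 1 ≤ k)
    (rest : List Arrow) (hrest : rest.length = k - 1) :
    bracket t (Arrow.sw :: rest) =
      MvPolynomial.X (((rest.count Arrow.se : ℤ) + 1, t)) * bracket t (Arrow.se :: rest) := by
  have h := bracketAux_swap t rest.reverse
  rw [List.count_reverse] at h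
  simpa only [bracket, List.reverse_cons] using h
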